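/- J1 convergence implies S-convergence (Section 4, item 3): Let x_n, x_0 ∈ D([0,T]) and suppose x_n → x_0 in Skorokhod's J1 sense, i.e. there exist strictly increasing continuous bijections λ_n of [0,T] onto itself such that sup_{t ∈ [0,T]} |λ_n(t) − t| → 0 and sup_{t ∈ [0,T]} |x_n(λ_n(t)) − x_0(t)| → 0. Then x_n →_S x_0. -/

import Mathlib

open MeasureTheory Filter Set Topology

noncomputable section

/-- `x` is càdlàg on `[0,T]`: right-continuous at every `t ∈ [0,T)` and
admitting a left limit at every `t ∈ (0,T]`. -/
def Cadlag (T : ℝ) (x : ℝ → ℝ) : Prop :=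
  (∀ t ∈ Set.Ico (0:ℝ) T, Filter.Tendsto x (nhdsWithin t (Set.Ioi t)) (nhds (x t))) ∧
  (∀ t ∈ Set.Ioc (0:ℝ) T, ∃ L : ℝ, Filter.Tendsto x (nhdsWithin t (Set.Iio t)) (nhds L))

/-- membership in `𝕍`: càdlàg of finite total variation on `[0,T]`. -/
def MemV (T : ℝ) (v : ℝ → ℝ) : Prop :=
  Cadlag T v ∧ BoundedVariationOn v (Set.Icc 0 T)

/-- `μ` is the finite signed (Lebesgue–Stieltjes) measure induced by `v` on `[0,T]`:
`μ([0,t]) = v(t)` for `t ∈ [0,T]`, and `μ` vanishes outside `[0,T]`. -/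
def Represents (T : ℝ) (μ : MeasureTheory.SignedMeasure ℝ) (v : ℝ → ℝ) : Prop :=
  (∀ t ∈ Set.Icc (0:ℝ) T, μ (Set.Icc 0 t) = v t) ∧
  (∀ s : Set ℝ, MeasurableSet s → s ∩ Set.Icc (0:ℝ) T = ∅ → μ s = 0)

/-- Integral of `f` against a signed measure. -/
noncomputable def sInt (μ : MeasureTheory.SignedMeasure ℝ) (f : ℝ → ℝ) : ℝ :=
  (∫ t, f t ∂μ.toJordanDecomposition.posPart) - (∫ t, f t ∂μ.toJordanDecomposition.negPart)

/-- `∫_{[0,T]} f dv` : integral of `f` with respect to the Lebesgue–Stieltjes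
signed measure induced by `v` on `[0,T]`. -/
noncomputable def intD (T : ℝ) (f v : ℝ → ℝ) : ℝ :=
  letI := Classical.propDecidable (∃ μ : MeasureTheory.SignedMeasure ℝ, Represents T μ v)
  if h : ∃ μ : MeasureTheory.SignedMeasure ℝ, Represents T μ v then sInt h.choose f else 0

/-- S-convergence `x_n →_S x₀` on `D([0,T])`. -/
def SConv (T : ℝ) (x : ℕ → ℝ → ℝ) (x₀ : ℝ → ℝ) : Prop :=
  ∀ ε > (0:ℝ), ∃ v : ℕ → ℝ → ℝ, ∃ v₀ : ℝ → ℝ,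
    (∀ n, MemV T (v n)) ∧ MemV T v₀ ∧
    (∀ n, ∀ t ∈ Set.Icc (0:ℝ) T, |x n t - v n t| ≤ ε) ∧
    (∀ t ∈ Set.Icc (0:ℝ) T, |x₀ t - v₀ t| ≤ ε) ∧
    (∀ f : ℝ → ℝ, Continuous f →
      Filter.Tendsto (fun n => intD T f (v n)) Filter.atTop (nhds (intD T f v₀)))

/-- `x_n ⇒*_S x₀` : every subsequence contains a further subsequence `→_S`-converging to `x₀`. -/
def SStarConv (T : ℝ) (x : ℕ → ℝ → ℝ) (x₀ : ℝ → ℝ) : Prop :=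
  ∀ φ : ℕ → ℕ, StrictMono φ →
    ∃ ψ : ℕ → ℕ, StrictMono ψ ∧ SConv T (fun k => x (φ (ψ k))) x₀

/-- membership in `𝔸([0,T])`: continuous, of finite variation, vanishing at `0`. -/
def MemA (T : ℝ) (A : ℝ → ℝ) : Prop :=
  ContinuousOn A (Set.Icc 0 T) ∧ BoundedVariationOn A (Set.Icc 0 T) ∧ A 0 = 0

/-- `A_n →_τ A₀` : uniform convergence on `[0,T]` together with uniformly bounded
total variations. -/
def TauConv (T : ℝ) (A : ℕ → ℝ → ℝ) (A₀ : ℝ → ℝ) : Prop :=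
  TendstoUniformlyOn (fun n => A n) A₀ Filter.atTop (Set.Icc 0 T) ∧
  ∃ M : ℝ, ∀ n, eVariationOn (A n) (Set.Icc 0 T) ≤ ENNReal.ofReal M

/-- `x` has (at least) `k` up-crossings of the levels `a < b` on `[0,T]`. -/
def HasUpcrossings (T a b : ℝ) (x : ℝ → ℝ) (k : ℕ) : Prop :=
  ∃ s u : Fin k → ℝ, (∀ i, 0 ≤ s i ∧ s i < u i ∧ u i ≤ T) ∧
    (∀ i j : Fin k, i < j → u i < s j) ∧
    (∀ i, x (s i) < a ∧ b < x (u i))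

/-- `x` has (at least) `k` `η`-oscillations on `[0,T]`. -/
def HasOscillations (T η : ℝ) (x : ℝ → ℝ) (k : ℕ) : Prop :=
  ∃ s u : Fin k → ℝ, (∀ i, 0 ≤ s i ∧ s i < u i ∧ u i ≤ T) ∧
    (∀ i j : Fin k, i < j → u i ≤ s j) ∧
    (∀ i, |x (u i) - x (s i)| > η)


/-- `l` is an admissible time change of `[a,b]`: a strictly increasing continuous
bijection of `[a,b]` onto itself. -/
def TimeChange (a b : ℝ) (l : ℝ → ℝ) : Prop :=
  ContinuousOn l (Set.Icc a b) ∧ StrictMonoOn l (Set.Icc a b) ∧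
    l a = a ∧ l b = b ∧ Set.MapsTo l (Set.Icc a b) (Set.Icc a b)

/-- The step function with jumps `p.2` at times `p.1`, for `p` in the list `l`. -/
def stepFun (l : List (ℝ × ℝ)) (t : ℝ) : ℝ :=
  (l.map fun p => if p.1 ≤ t then p.2 else 0).sum

/-- The discrete measure with masses `(p.2)⁺` at `p.1`, for `p` in the list `l`. -/
def posMeasure (l : List (ℝ × ℝ)) : Measure ℝ :=
  (l.map fun p => ENNReal.ofReal p.2 • Measure.dirac p.1).sum

/-- The discrete measure with masses `(p.2)⁻` at `p.1`, for `p` in the list `l`. -/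
def negMeasure (l : List (ℝ × ℝ)) : Measure ℝ :=
  (l.map fun p => ENNReal.ofReal (-p.2) • Measure.dirac p.1).sum

@[simp] lemma stepFun_nil (t : ℝ) : stepFun [] t = 0 := by simp [stepFun]

@[simp] lemma stepFun_cons (p : ℝ × ℝ) (l : List (ℝ × ℝ)) (t : ℝ) :
    stepFun (p :: l) t = (if p.1 ≤ t then p.2 else 0) + stepFun l t := by simp [stepFun]

@[simp] lemma posMeasure_nil : posMeasure [] = 0 := by simp [posMeasure]

@[simp] lemma posMeasure_cons (p : ℝ × ℝ) (l : List (ℝ × ℝ)) :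
    posMeasure (p :: l) = ENNReal.ofReal p.2 • Measure.dirac p.1 + posMeasure l := by
  simp [posMeasure]

@[simp] lemma negMeasure_nil : negMeasure [] = 0 := by simp [negMeasure]

@[simp] lemma negMeasure_cons (p : ℝ × ℝ) (l : List (ℝ × ℝ)) :
    negMeasure (p :: l) = ENNReal.ofReal (-p.2) • Measure.dirac p.1 + negMeasure l := by
  simp [negMeasure]

lemma isFiniteMeasure_ofReal_smul_dirac (c a : ℝ) :
    IsFiniteMeasure (ENNReal.ofReal c • Measure.dirac a) :=
  Measure.smul_finite _ ENNReal.ofReal_ne_top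

instance isFiniteMeasure_posMeasure (l : List (ℝ × ℝ)) : IsFiniteMeasure (posMeasure l) := by
  induction l with
  | nil => rw [posMeasure_nil]; infer_instance
  | cons p l ih =>
    have := isFiniteMeasure_ofReal_smul_dirac p.2 p.1
    rw [posMeasure_cons]; infer_instance

instance isFiniteMeasure_negMeasure (l : List (ℝ × ℝ)) : IsFiniteMeasure (negMeasure l) := by
  induction l with
  | nil => rw [negMeasure_nil]; infer_instance
  | cons p l ih =>
    have := isFiniteMeasure_ofReal_smul_dirac (-p.2) p.1
    rw [negMeasure_cons]; infer_instance

lemma integrable_ofReal_smul_dirac (c a : ℝ) (f : ℝ → ℝ) :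
    Integrable f (ENNReal.ofReal c • Measure.dirac a) :=
  (integrable_dirac (by simp)).smul_measure ENNReal.ofReal_ne_top

lemma integrable_posMeasure (l : List (ℝ × ℝ)) (f : ℝ → ℝ) : Integrable f (posMeasure l) := by
  induction l with
  | nil => simp
  | cons p l ih =>
    rw [posMeasure_cons]
    exact (integrable_ofReal_smul_dirac _ _ f).add_measure ih

lemma integrable_negMeasure (l : List (ℝ × ℝ)) (f : ℝ → ℝ) : Integrable f (negMeasure l) := by
  induction l with
  | nil => simp
  | cons p l ih =>
    rw [negMeasure_cons]
    exact (integrable_ofReal_smul_dirac _ _ f).add_measure ih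

lemma max_zero_sub_max_neg_zero (c : ℝ) : max c 0 - max (-c) 0 = c := by
  rcases le_total c 0 with h | h <;> simp [h]

lemma integral_posMeasure_sub_negMeasure (l : List (ℝ × ℝ)) (f : ℝ → ℝ) :
    ∫ t, f t ∂posMeasure l - ∫ t, f t ∂negMeasure l = (l.map fun p => p.2 * f p.1).sum := by
  induction l with
  | nil => simp
  | cons p l ih =>
    rw [posMeasure_cons, negMeasure_cons,
      integral_add_measure (integrable_ofReal_smul_dirac _ _ f) (integrable_posMeasure l f),
      integral_add_measure (integrable_ofReal_smul_dirac _ _ f) (integrable_negMeasure l f),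
      List.map_cons, List.sum_cons, ← ih, integral_smul_measure, integral_smul_measure,
      integral_dirac]
    simp only [ENNReal.toReal_ofReal', smul_eq_mul]
    linear_combination f p.1 * max_zero_sub_max_neg_zero p.2

lemma real_posMeasure_sub_negMeasure (l : List (ℝ × ℝ)) {s : Set ℝ} (hs : MeasurableSet s) :
    (posMeasure l).real s - (negMeasure l).real s
      = (l.map fun p => p.2 * s.indicator 1 p.1).sum := by
  rw [← integral_posMeasure_sub_negMeasure, integral_indicator_one hs, integral_indicator_one hs]

lemma real_posMeasure_sub_negMeasure_Icc {l : List (ℝ × ℝ)} (hl : ∀ p ∈ l, 0 ≤ p.1) (t : ℝ) :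
    (posMeasure l).real (Icc 0 t) - (negMeasure l).real (Icc 0 t) = stepFun l t := by
  rw [real_posMeasure_sub_negMeasure l measurableSet_Icc, stepFun]
  congr 1
  refine List.map_congr_left fun p hp => ?_
  simp [indicator_apply, hl p hp]

lemma real_posMeasure_sub_negMeasure_of_disjoint {l : List (ℝ × ℝ)} {S s : Set ℝ}
    (hl : ∀ p ∈ l, p.1 ∈ S) (hs : MeasurableSet s) (hd : s ∩ S = ∅) :
    (posMeasure l).real s - (negMeasure l).real s = 0 := by
  rw [real_posMeasure_sub_negMeasure l hs]
  refine List.sum_eq_zero fun y hy => ?_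
  obtain ⟨p, hp, rfl⟩ := List.mem_map.1 hy
  have : p.1 ∉ s := fun h => by
    have : p.1 ∈ s ∩ S := ⟨h, hl p hp⟩
    simp [hd] at this
  simp [this]

lemma toSignedMeasure_sub_apply (μ ν : Measure ℝ) [IsFiniteMeasure μ] [IsFiniteMeasure ν]
    {s : Set ℝ} (hs : MeasurableSet s) :
    (μ.toSignedMeasure - ν.toSignedMeasure) s = μ.real s - ν.real s := by
  rw [_root_.sub_apply, Measure.toSignedMeasure_apply_measurable hs,
    Measure.toSignedMeasure_apply_measurable hs]

lemma exists_represents_stepFun {T : ℝ} {l : List (ℝ × ℝ)} (hl : ∀ p ∈ l, p.1 ∈ Icc 0 T) :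
    ∃ μ : SignedMeasure ℝ, Represents T μ (stepFun l) := by
  refine ⟨(posMeasure l).toSignedMeasure - (negMeasure l).toSignedMeasure, fun t _ => ?_,
    fun s hs hd => ?_⟩
  · rw [toSignedMeasure_sub_apply _ _ measurableSet_Icc,
      real_posMeasure_sub_negMeasure_Icc fun p hp => (hl p hp).1]
  · rw [toSignedMeasure_sub_apply _ _ hs,
      real_posMeasure_sub_negMeasure_of_disjoint hl hs hd]

/-- If `p + ν = q + μ` with `p ⟂ₘ q`, then `p ≤ μ`. -/
lemma le_of_add_eq_add_of_mutuallySingular {α : Type*} [MeasurableSpace α] {p q μ ν : Measure α}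
    (hpq : p ⟂ₘ q) (h : p + ν = q + μ) : p ≤ μ := by
  obtain ⟨S, hS, hpS, hqS⟩ := hpq
  refine Measure.le_iff.2 fun A hA => ?_
  calc p A ≤ p (A ∩ Sᶜ) + p S := by
        refine (measure_mono fun a ha => ?_).trans (measure_union_le _ _)
        by_cases haS : a ∈ S <;> simp [ha, haS]
    _ = p (A ∩ Sᶜ) := by rw [hpS, add_zero]
    _ ≤ (p + ν) (A ∩ Sᶜ) := by simp
    _ = q (A ∩ Sᶜ) + μ (A ∩ Sᶜ) := by rw [h]; simp
    _ = μ (A ∩ Sᶜ) := by rw [measure_mono_null inter_subset_right hqS, zero_add]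
    _ ≤ μ A := measure_mono inter_subset_left

lemma signedMeasure_apply_eq_real_sub (σ : SignedMeasure ℝ) {s : Set ℝ} (hs : MeasurableSet s) :
    σ s = σ.toJordanDecomposition.posPart.real s - σ.toJordanDecomposition.negPart.real s := by
  conv_lhs => rw [← SignedMeasure.toSignedMeasure_toJordanDecomposition σ]
  rw [JordanDecomposition.toSignedMeasure, toSignedMeasure_sub_apply _ _ hs]

lemma Represents.apply_Iic_eq {T : ℝ} (hT : 0 < T) {l : List (ℝ × ℝ)}
    (hl : ∀ p ∈ l, p.1 ∈ Icc 0 T) {σ : SignedMeasure ℝ} (h : Represents T σ (stepFun l)) (t : ℝ) :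
    σ (Iic t) = (posMeasure l).real (Iic t) - (negMeasure l).real (Iic t) := by
  set τ : SignedMeasure ℝ := (posMeasure l).toSignedMeasure - (negMeasure l).toSignedMeasure
  have hτ_apply {s : Set ℝ} (hs : MeasurableSet s) :
      τ s = (posMeasure l).real s - (negMeasure l).real s :=
    toSignedMeasure_sub_apply _ _ hs
  rw [← hτ_apply measurableSet_Iic]
  have hsplit (ρ : SignedMeasure ℝ) : ρ (Iic t) = ρ (Iic t ∩ Icc 0 T) + ρ (Iic t \ Icc 0 T) := by
    rw [← VectorMeasure.of_union disjoint_sdiff_inter.symm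
      (measurableSet_Iic.inter measurableSet_Icc) (measurableSet_Iic.diff measurableSet_Icc),
      inter_union_sdiff]
  have hdiff : (Iic t \ Icc 0 T) ∩ Icc 0 T = ∅ := sdiff_inter_self
  have hdm : MeasurableSet (Iic t \ Icc 0 T) := measurableSet_Iic.diff measurableSet_Icc
  rw [hsplit σ, hsplit τ, h.2 _ hdm hdiff, hτ_apply hdm,
    real_posMeasure_sub_negMeasure_of_disjoint hl hdm hdiff, add_zero, add_zero]
  rcases lt_or_ge t 0 with ht | ht
  · have : Iic t ∩ Icc 0 T = ∅ := by
      ext s; simp only [mem_inter_iff, mem_Iic, mem_Icc, mem_empty_iff_false]; grind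
    simp [this]
  · have : Iic t ∩ Icc 0 T = Icc 0 (min t T) := by
      ext s; simp only [mem_inter_iff, mem_Iic, mem_Icc, le_min_iff]; grind
    rw [this, h.1 _ ⟨le_min ht hT.le, min_le_right _ _⟩, hτ_apply measurableSet_Icc,
      real_posMeasure_sub_negMeasure_Icc fun p hp => (hl p hp).1]

lemma Represents.sInt_eq {T : ℝ} (hT : 0 < T) {l : List (ℝ × ℝ)} (hl : ∀ p ∈ l, p.1 ∈ Icc 0 T)
    {σ : SignedMeasure ℝ} (h : Represents T σ (stepFun l)) (f : ℝ → ℝ) :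
    sInt σ f = (l.map fun p => p.2 * f p.1).sum := by
  set p := σ.toJordanDecomposition.posPart
  set q := σ.toJordanDecomposition.negPart
  have hsing : p ⟂ₘ q := σ.toJordanDecomposition.mutuallySingular
  have hadd : p + negMeasure l = q + posMeasure l := by
    refine Measure.ext_of_Iic _ _ fun t => ?_
    rw [← measureReal_eq_measureReal_iff, measureReal_add_apply, measureReal_add_apply]
    have := h.apply_Iic_eq hT hl t
    rw [signedMeasure_apply_eq_real_sub σ measurableSet_Iic] at this
    linarith
  have hpf : Integrable f p :=
    (integrable_posMeasure l f).mono_measure (le_of_add_eq_add_of_mutuallySingular hsing hadd)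
  have hqf : Integrable f q :=
    (integrable_negMeasure l f).mono_measure
      (le_of_add_eq_add_of_mutuallySingular hsing.symm hadd.symm)
  have hint := congrArg (fun ρ : Measure ℝ => ∫ t, f t ∂ρ) hadd
  rw [integral_add_measure hpf (integrable_negMeasure l f),
    integral_add_measure hqf (integrable_posMeasure l f)] at hint
  rw [sInt, ← integral_posMeasure_sub_negMeasure]
  linarith

lemma intD_stepFun {T : ℝ} (hT : 0 < T) {l : List (ℝ × ℝ)} (hl : ∀ p ∈ l, p.1 ∈ Icc 0 T)
    (f : ℝ → ℝ) : intD T f (stepFun l) = (l.map fun p => p.2 * f p.1).sum := by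
  have h := exists_represents_stepFun hl
  rw [intD, dif_pos h]
  exact h.choose_spec.sInt_eq hT hl f

lemma boundedVariationOn_fun_add {f g : ℝ → ℝ} {s : Set ℝ} (hf : BoundedVariationOn f s)
    (hg : BoundedVariationOn g s) : BoundedVariationOn (fun t => f t + g t) s := by
  refine ne_top_of_le_ne_top (ENNReal.add_ne_top.2 ⟨hf, hg⟩) (iSup_le fun p => ?_)
  calc ∑ i ∈ Finset.range p.1, edist (f (p.2.1 (i + 1)) + g (p.2.1 (i + 1)))
          (f (p.2.1 i) + g (p.2.1 i))
      ≤ ∑ i ∈ Finset.range p.1, (edist (f (p.2.1 (i + 1))) (f (p.2.1 i)) +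
          edist (g (p.2.1 (i + 1))) (g (p.2.1 i))) :=
        Finset.sum_le_sum fun i _ => edist_add_add_le _ _ _ _
    _ = _ := Finset.sum_add_distrib
    _ ≤ _ := add_le_add (eVariationOn.sum_le p.2.2.1 p.2.2.2)
        (eVariationOn.sum_le p.2.2.1 p.2.2.2)

lemma cadlag_ite (T a c : ℝ) : Cadlag T fun t => if a ≤ t then c else 0 := by
  refine ⟨fun t _ => ?_, fun t _ => ?_⟩
  · refine tendsto_const_nhds.congr' ?_
    by_cases h : a ≤ t
    · filter_upwards [self_mem_nhdsWithin] with s hs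
      rw [if_pos h, if_pos (h.trans (le_of_lt hs))]
    · filter_upwards [mem_nhdsWithin_of_mem_nhds (Iio_mem_nhds (not_le.1 h))] with s hs
      rw [if_neg h, if_neg (not_le.2 hs)]
  · by_cases h : a < t
    · refine ⟨c, tendsto_const_nhds.congr' ?_⟩
      filter_upwards [mem_nhdsWithin_of_mem_nhds (Ioi_mem_nhds h)] with s hs
      rw [if_pos (le_of_lt hs)]
    · refine ⟨0, tendsto_const_nhds.congr' ?_⟩
      filter_upwards [self_mem_nhdsWithin] with s hs
      rw [if_neg (not_le.2 (lt_of_lt_of_le hs (not_lt.1 h)))]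

lemma boundedVariationOn_ite (a c : ℝ) (s : Set ℝ) :
    BoundedVariationOn (fun t => if a ≤ t then c else 0) s := by
  have h1 : BoundedVariationOn (fun _ : ℝ => c) s :=
    MonotoneOn.boundedVariationOn (C := |c|) (fun _ _ _ _ _ => le_rfl) fun _ _ => le_rfl
  have h2 : BoundedVariationOn (fun t : ℝ => if a ≤ t then (1 : ℝ) else 0) s := by
    refine MonotoneOn.boundedVariationOn (C := 1) (fun u _ v _ huv => ?_) fun u _ => ?_
    · grind
    · split_ifs <;> norm_num
  simpa [Pi.mul_def] using h1.mul h2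

lemma Cadlag.fun_add {T : ℝ} {x y : ℝ → ℝ} (hx : Cadlag T x) (hy : Cadlag T y) :
    Cadlag T fun t => x t + y t := by
  refine ⟨fun t ht => (hx.1 t ht).add (hy.1 t ht), fun t ht => ?_⟩
  obtain ⟨L, hL⟩ := hx.2 t ht
  obtain ⟨M, hM⟩ := hy.2 t ht
  exact ⟨L + M, hL.add hM⟩

lemma memV_stepFun (T : ℝ) (l : List (ℝ × ℝ)) : MemV T (stepFun l) := by
  induction l with
  | nil =>
    have : stepFun [] = fun t => if (0 : ℝ) ≤ t then (0 : ℝ) else 0 := by ext; simp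
    rw [this]
    exact ⟨cadlag_ite T 0 0, boundedVariationOn_ite 0 0 _⟩
  | cons p l ih =>
    have : stepFun (p :: l) = fun t => (if p.1 ≤ t then p.2 else 0) + stepFun l t := by
      ext; simp
    rw [this]
    exact ⟨(cadlag_ite T p.1 p.2).fun_add ih.1,
      boundedVariationOn_fun_add (boundedVariationOn_ite p.1 p.2 _) ih.2⟩

lemma stepFun_eq_of_le {l : List (ℝ × ℝ)} {a t : ℝ} (hl : ∀ p ∈ l, p.1 ≤ a) (hat : a ≤ t) :
    stepFun l t = stepFun l a := by
  rw [stepFun, stepFun]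
  congr 1
  refine List.map_congr_left fun p hp => ?_
  rw [if_pos (hl p hp), if_pos ((hl p hp).trans hat)]

/-- `x` is within `ε` on `[0,s)` of a step function whose jumps lie in `[0,s)`. -/
def StepApprox (x : ℝ → ℝ) (ε s : ℝ) : Prop :=
  ∃ l : List (ℝ × ℝ), (∀ p ∈ l, p.1 ∈ Ico 0 s) ∧ ∀ t ∈ Ico 0 s, |x t - stepFun l t| ≤ ε

lemma stepFun_cons_sub_eq {x : ℝ → ℝ} {a t : ℝ} {l : List (ℝ × ℝ)} (hl : ∀ p ∈ l, p.1 ∈ Ico 0 a)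
    (hat : a ≤ t) : stepFun ((a, x a - stepFun l a) :: l) t = x a := by
  simp [hat, stepFun_eq_of_le (fun p hp => (hl p hp).2.le) hat]

lemma StepApprox.extend {x : ℝ → ℝ} {ε a b : ℝ} (h : StepApprox x ε a) (ha : 0 ≤ a) (hab : a < b)
    (hx : ∀ t ∈ Ico a b, |x t - x a| ≤ ε) : StepApprox x ε b := by
  obtain ⟨l, hl, hlx⟩ := h
  refine ⟨(a, x a - stepFun l a) :: l, fun p hp => ?_, fun t ht => ?_⟩
  · rcases List.mem_cons.1 hp with rfl | hp
    · exact ⟨ha, hab⟩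
    · exact ⟨(hl p hp).1, (hl p hp).2.trans hab⟩
  · rcases lt_or_ge t a with h | h
    · simpa [not_le.2 h] using hlx t ⟨ht.1, h⟩
    · rw [stepFun_cons_sub_eq hl h]
      exact hx t ⟨h, ht.2⟩

lemma Cadlag.stepApprox {T : ℝ} (hT : 0 < T) {x : ℝ → ℝ} (hx : Cadlag T x) {ε : ℝ} (hε : 0 < ε) :
    StepApprox x ε T := by
  set S : Set ℝ := {s | s ∈ Icc 0 T ∧ StepApprox x ε s}
  have h0 : (0 : ℝ) ∈ S := ⟨⟨le_rfl, hT.le⟩, [], by simp, by simp⟩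
  have hbdd : BddAbove S := ⟨T, fun s hs => hs.1.2⟩
  set m := sSup S with hm
  have hm0 : 0 ≤ m := le_csSup hbdd h0
  have hmT : m ≤ T := csSup_le ⟨0, h0⟩ fun s hs => hs.1.2
  have hmS : StepApprox x ε m := by
    rcases hm0.eq_or_lt with h | h
    · rw [← h]; exact h0.2
    · obtain ⟨L, hL⟩ := hx.2 m ⟨h, hmT⟩
      have hev : ∀ᶠ t in 𝓝[<] m, |x t - L| < ε / 2 := by
        simpa [Real.dist_eq] using Metric.tendsto_nhds.1 hL (ε / 2) (half_pos hε)
      obtain ⟨u, hu, hux⟩ := (mem_nhdsLT_iff_exists_Ioo_subset).1 hev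
      obtain ⟨s, hs, hus⟩ := exists_lt_of_lt_csSup ⟨0, h0⟩ hu
      rcases (le_csSup hbdd hs).eq_or_lt with hsm | hsm
      · rw [hm, ← hsm]; exact hs.2
      · refine hs.2.extend hs.1.1 hsm fun t ht => ?_
        have e1 : |x t - L| < ε / 2 := hux ⟨hus.trans_le ht.1, ht.2⟩
        have e2 : |x s - L| < ε / 2 := hux ⟨hus, hsm⟩
        rw [abs_lt] at e1 e2
        rw [abs_le]
        constructor <;> linarith
  rcases hmT.eq_or_lt with h | h
  · rwa [← h]
  · have hev : ∀ᶠ t in 𝓝[>] m, |x t - x m| < ε := by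
      simpa [Real.dist_eq] using Metric.tendsto_nhds.1 (hx.1 m ⟨hm0, h⟩) ε hε
    obtain ⟨u, hu, hux⟩ := (mem_nhdsGT_iff_exists_Ioo_subset).1 hev
    have hlt : m < min u T := lt_min hu h
    have hmem : min u T ∈ S := by
      refine ⟨⟨hm0.trans hlt.le, min_le_right _ _⟩, hmS.extend hm0 hlt fun t ht => ?_⟩
      rcases ht.1.eq_or_lt with rfl | hmt
      · simpa using hε.le
      · exact le_of_lt (hux ⟨hmt, ht.2.trans_le (min_le_left _ _)⟩)
    exact absurd (le_csSup hbdd hmem) (not_le.2 hlt)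

/-- A càdlàg function on `[0,T]` is a uniform limit of step functions. -/
lemma Cadlag.exists_stepFun {T : ℝ} (hT : 0 < T) {x : ℝ → ℝ} (hx : Cadlag T x) {ε : ℝ}
    (hε : 0 < ε) : ∃ l : List (ℝ × ℝ), (∀ p ∈ l, p.1 ∈ Icc 0 T) ∧
      ∀ t ∈ Icc 0 T, |x t - stepFun l t| ≤ ε := by
  obtain ⟨l, hl, hlx⟩ := hx.stepApprox hT hε
  refine ⟨(T, x T - stepFun l T) :: l, fun p hp => ?_, fun t ht => ?_⟩
  · rcases List.mem_cons.1 hp with rfl | hp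
    · exact ⟨hT.le, le_rfl⟩
    · exact ⟨(hl p hp).1, (hl p hp).2.le⟩
  · rcases ht.2.eq_or_lt with rfl | h
    · rw [stepFun_cons_sub_eq hl le_rfl]
      simpa using hε.le
    · simpa [not_le.2 h] using hlx t ⟨ht.1, h⟩

/-- The jump times of the list `l` moved by `g`. -/
def moveJumps (g : ℝ → ℝ) (l : List (ℝ × ℝ)) : List (ℝ × ℝ) :=
  l.map fun p => (g p.1, p.2)

lemma stepFun_moveJumps {g : ℝ → ℝ} {S : Set ℝ} (hg : StrictMonoOn g S) {l : List (ℝ × ℝ)}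
    (hl : ∀ p ∈ l, p.1 ∈ S) {t : ℝ} (ht : t ∈ S) :
    stepFun (moveJumps g l) (g t) = stepFun l t := by
  rw [stepFun, stepFun, moveJumps, List.map_map]
  congr 1
  refine List.map_congr_left fun p hp => ?_
  simp [hg.le_iff_le (hl p hp) ht]

lemma TimeChange.surjOn {a b : ℝ} (hab : a ≤ b) {g : ℝ → ℝ} (hg : TimeChange a b g) :
    SurjOn g (Icc a b) (Icc a b) := by
  have := intermediate_value_Icc hab hg.1
  rwa [hg.2.2.1, hg.2.2.2.1] at this

/-- `J₁` convergence implies `S`-convergence (Section 4, item 3). -/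
theorem stmt19 (T : ℝ) (hT : 0 < T) (x : ℕ → ℝ → ℝ) (x₀ : ℝ → ℝ)
    (hx : ∀ n, Cadlag T (x n)) (hx₀ : Cadlag T x₀)
    (lam : ℕ → ℝ → ℝ) (hlam : ∀ n, TimeChange 0 T (lam n))
    (h1 : ∀ δ > (0:ℝ), ∃ N : ℕ, ∀ n ≥ N, ∀ t ∈ Set.Icc (0:ℝ) T, |lam n t - t| ≤ δ)
    (h2 : ∀ δ > (0:ℝ), ∃ N : ℕ, ∀ n ≥ N, ∀ t ∈ Set.Icc (0:ℝ) T, |x n (lam n t) - x₀ t| ≤ δ) :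
    SConv T x x₀ := by
  intro ε hε
  obtain ⟨l, hl, hlx⟩ := hx₀.exists_stepFun hT (half_pos hε)
  obtain ⟨N, hN⟩ := h2 (ε / 2) (half_pos hε)
  choose m _ hmx using fun n => (hx n).exists_stepFun hT hε
  have hmove (n : ℕ) : ∀ p ∈ moveJumps (lam n) l, p.1 ∈ Icc 0 T := fun p hp => by
    obtain ⟨q, hq, rfl⟩ := List.mem_map.1 hp
    exact (hlam n).2.2.2.2 (hl q hq)
  refine ⟨fun n => stepFun (if N ≤ n then moveJumps (lam n) l else m n), stepFun l,
    fun n => memV_stepFun T _, memV_stepFun T l, fun n s hs => ?_,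
    fun t ht => (hlx t ht).trans (half_le_self hε.le), fun f hf => ?_⟩
  · beta_reduce
    by_cases hn : N ≤ n
    · obtain ⟨t, ht, rfl⟩ := (hlam n).surjOn hT.le hs
      rw [if_pos hn, stepFun_moveJumps (hlam n).2.1 hl ht]
      linarith [abs_sub_le (x n (lam n t)) (x₀ t) (stepFun l t), hN n hn t ht, hlx t ht]
    · rw [if_neg hn]
      exact hmx n s hs
  · have hlim : Tendsto (fun n => (l.map fun p => p.2 * f (lam n p.1)).sum) atTop
        (𝓝 (l.map fun p => p.2 * f p.1).sum) := by
      refine tendsto_list_sum l fun p hp => (Tendsto.const_mul _ ?_)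
      refine (hf.tendsto p.1).comp (Metric.tendsto_atTop.2 fun δ hδ => ?_)
      obtain ⟨K, hK⟩ := h1 (δ / 2) (half_pos hδ)
      exact ⟨K, fun n hn => (hK n hn p.1 (hl p hp)).trans_lt (half_lt_self hδ)⟩
    rw [intD_stepFun hT hl]
    refine hlim.congr' ?_
    filter_upwards [eventually_ge_atTop N] with n hn
    rw [if_pos hn, intD_stepFun hT (hmove n), moveJumps, List.map_map]
    rfl

end
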